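/- arXiv:1712.08598 — 3 statements merged into one kernel-verified Lean document; each statement's English description precedes it below -/
import Mathlib

section
/- Let n ≥ 1 be an integer, a ∈ ℝ, and let v : ℝⁿ × (0,∞) → ℝ be three times continuously differentiable and satisfy Δ_x v + (a/y) ∂_y v + ∂_y² v = 0 at every point of ℝⁿ × (0,∞). Define w(x,y) := −y^a ∂_y v(x,y). Then w satisfies the conjugate equation Δ_x w − (a/y) ∂_y w + ∂_y² w = 0 at every point of ℝⁿ × (0,∞). -/
open Real

/-- Partial derivative in the last (vertical) variable `y`. -/
noncomputable def partialY {E : Type*} (F : E × ℝ → ℝ) (p : E × ℝ) : ℝ :=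
  deriv (fun t : ℝ => F (p.1, t)) p.2

/-- Second partial derivative in the last (vertical) variable `y`. -/
noncomputable def partialYY {E : Type*} (F : E × ℝ → ℝ) (p : E × ℝ) : ℝ :=
  deriv (deriv (fun t : ℝ => F (p.1, t))) p.2

/-- Laplacian in the horizontal variables `x ∈ ℝⁿ`. -/
noncomputable def lapX (n : ℕ) (F : EuclideanSpace ℝ (Fin n) × ℝ → ℝ)
    (p : EuclideanSpace ℝ (Fin n) × ℝ) : ℝ :=
  ∑ i : Fin n,
    deriv (deriv (fun t : ℝ => F (p.1 + t • EuclideanSpace.single i (1 : ℝ), p.2))) 0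

open Filter Topology

theorem isOpen_upperHalf {E : Type*} [TopologicalSpace E] : IsOpen {p : E × ℝ | 0 < p.2} :=
  isOpen_lt continuous_const continuous_snd

section DirDeriv

variable {E : Type*} [NormedAddCommGroup E] [NormedSpace ℝ E]

/-- The derivative of `F` in the direction `u`, as a function of the base point. -/
noncomputable def dirDeriv (u : E) (F : E → ℝ) (q : E) : ℝ := fderiv ℝ F q u

theorem ContDiffOn.dirDeriv {U : Set E} (hU : IsOpen U) {F : E → ℝ} {m k : WithTop ℕ∞}
    (hF : ContDiffOn ℝ k F U) (hmk : m + 1 ≤ k) (u : E) :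
    ContDiffOn ℝ m (dirDeriv u F) U :=
  (hF.fderiv_of_isOpen hU hmk).clm_apply contDiffOn_const

theorem Set.EqOn.dirDeriv {U : Set E} (hU : IsOpen U) {F G : E → ℝ} (h : Set.EqOn F G U)
    (u : E) : Set.EqOn (dirDeriv u F) (dirDeriv u G) U := fun q hq => by
  simp only [_root_.dirDeriv, (h.eventuallyEq_of_mem (hU.mem_nhds hq)).fderiv_eq]

theorem dirDeriv_comm {U : Set E} (hU : IsOpen U) {F : E → ℝ} (hF : ContDiffOn ℝ 2 F U)
    (u v : E) : Set.EqOn (dirDeriv u (dirDeriv v F)) (dirDeriv v (dirDeriv u F)) U := by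
  intro q hq
  have hFq : ContDiffAt ℝ 2 F q := hF.contDiffAt (hU.mem_nhds hq)
  have hd : DifferentiableAt ℝ (fderiv ℝ F) q :=
    (hFq.fderiv_right (m := 1) (by norm_num)).differentiableAt (by norm_num)
  have hsymm : IsSymmSndFDerivAt ℝ F q := hFq.isSymmSndFDerivAt (by simp)
  have key (a b : E) : dirDeriv a (dirDeriv b F) q = fderiv ℝ (fderiv ℝ F) q a b := by
    have : HasFDerivAt (dirDeriv b F) _ q :=
      hd.hasFDerivAt.clm_apply (hasFDerivAt_const b q)
    rw [dirDeriv, this.fderiv]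
    simp
  rw [key, key, hsymm.eq]

theorem hasDerivAt_comp_line {F : E → ℝ} {u : E} {γ : ℝ → E} {t : ℝ}
    (hF : DifferentiableAt ℝ F (γ t)) (hγ : HasDerivAt γ u t) :
    HasDerivAt (fun s => F (γ s)) (dirDeriv u F (γ t)) t :=
  hF.hasFDerivAt.comp_hasDerivAt t hγ

/-- Along a line whose points near time `t` lie in `U`, the second derivative of a `C²` function
is its iterated directional derivative. -/
theorem deriv_deriv_comp_line {U : Set E} (hU : IsOpen U) {F : E → ℝ} (hF : ContDiffOn ℝ 2 F U)
    {u : E} {γ : ℝ → E} (hγ : ∀ t, HasDerivAt γ u t) {t : ℝ} (ht : γ t ∈ U) :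
    deriv (deriv fun s => F (γ s)) t = dirDeriv u (dirDeriv u F) (γ t) := by
  have hev : (deriv fun s => F (γ s)) =ᶠ[𝓝 t] fun s => dirDeriv u F (γ s) := by
    filter_upwards [(hγ t).continuousAt (hU.mem_nhds ht)] with s hs
    exact (hasDerivAt_comp_line ((hF.contDiffAt (hU.mem_nhds hs)).differentiableAt
      (by norm_num)) (hγ s)).deriv
  rw [hev.deriv_eq]
  have h1 : ContDiffOn ℝ 1 (dirDeriv u F) U := hF.dirDeriv hU (by norm_num) u
  exact (hasDerivAt_comp_line ((h1.contDiffAt (hU.mem_nhds ht)).differentiableAt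
    (by norm_num)) (hγ t)).deriv

theorem hasDerivAt_vertical (x : E) (t : ℝ) :
    HasDerivAt (fun s : ℝ => (x, s)) ((0 : E), (1 : ℝ)) t :=
  (hasDerivAt_const t x).prodMk (hasDerivAt_id t)

theorem hasDerivAt_horizontal (x u : E) (y t : ℝ) :
    HasDerivAt (fun s : ℝ => (x + s • u, y)) (u, (0 : ℝ)) t := by
  have h : HasDerivAt (fun s : ℝ => x + s • u) u t := by
    simpa using ((hasDerivAt_id t).smul_const u).const_add x
  exact h.prodMk (hasDerivAt_const t y)

theorem partialY_eq_dirDeriv {F : E × ℝ → ℝ} {p : E × ℝ} (hF : DifferentiableAt ℝ F p) :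
    partialY F p = dirDeriv (0, 1) F p :=
  (hasDerivAt_comp_line (γ := fun s => (p.1, s)) hF (hasDerivAt_vertical p.1 p.2)).deriv

end DirDeriv

theorem lapX_eq_sum_dirDeriv {n : ℕ} {F : EuclideanSpace ℝ (Fin n) × ℝ → ℝ}
    {U : Set (EuclideanSpace ℝ (Fin n) × ℝ)} (hU : IsOpen U) (hF : ContDiffOn ℝ 2 F U)
    {p : EuclideanSpace ℝ (Fin n) × ℝ} (hp : p ∈ U) :
    lapX n F p = ∑ i : Fin n, dirDeriv (EuclideanSpace.single i 1, 0)
      (dirDeriv (EuclideanSpace.single i 1, 0) F) p := by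
  refine Finset.sum_congr rfl fun i _ => ?_
  have h := deriv_deriv_comp_line hU hF
    (hasDerivAt_horizontal p.1 (EuclideanSpace.single i (1 : ℝ)) p.2) (t := 0) (by simpa using hp)
  simpa using h

theorem lapX_mul_of_snd (n : ℕ) (c : ℝ → ℝ) (G : EuclideanSpace ℝ (Fin n) × ℝ → ℝ)
    (p : EuclideanSpace ℝ (Fin n) × ℝ) :
    lapX n (fun q => c q.2 * G q) p = c p.2 * lapX n G p := by
  simp only [lapX, Finset.mul_sum, deriv_const_mul_field']

theorem lapX_congr_upperHalf {n : ℕ} {F G : EuclideanSpace ℝ (Fin n) × ℝ → ℝ}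
    (h : Set.EqOn F G {p | 0 < p.2}) {p : EuclideanSpace ℝ (Fin n) × ℝ} (hp : 0 < p.2) :
    lapX n F p = lapX n G p := by
  refine Finset.sum_congr rfl fun i _ => ?_
  rw [funext fun t : ℝ => h (x := (p.1 + t • EuclideanSpace.single i 1, p.2)) hp]

/-- The conjugate vertical operator applied to `w = -y ^ a * g`, by the Leibniz rule. -/
theorem conjugate_deriv_identity {a y : ℝ} (hy : 0 < y) {w g g' : ℝ → ℝ} {g'' : ℝ}
    (hw : ∀ t, 0 < t → w t = -t ^ a * g t) (hg : ∀ t, 0 < t → HasDerivAt g (g' t) t)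
    (hg' : HasDerivAt g' g'' y) :
    -(a / y) * deriv w y + deriv (deriv w) y
      = -y ^ a * (g'' + a / y * g' y - a / y ^ 2 * g y) := by
  have hpow (b t : ℝ) (ht : 0 < t) : HasDerivAt (fun s : ℝ => s ^ b) (b * t ^ (b - 1)) t :=
    Real.hasDerivAt_rpow_const (Or.inl ht.ne')
  have h1 (t : ℝ) (ht : 0 < t) : deriv w t = -(a * t ^ (a - 1)) * g t + -t ^ a * g' t := by
    have hev : w =ᶠ[𝓝 t] fun s => -s ^ a * g s := by
      filter_upwards [lt_mem_nhds ht] with s hs using hw s hs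
    rw [hev.deriv_eq]
    exact ((hpow a t ht).neg.mul (hg t ht)).deriv
  have hev : deriv w =ᶠ[𝓝 y] fun t => -(a * t ^ (a - 1)) * g t + -t ^ a * g' t := by
    filter_upwards [lt_mem_nhds hy] with s hs using h1 s hs
  have h2 := ((((hpow (a - 1) y hy).const_mul a).neg.mul (hg y hy)).add
    ((hpow a y hy).neg.mul hg')).deriv
  have h2' : deriv (deriv w) y = _ := hev.deriv_eq.trans h2
  rw [h2', h1 y hy, Real.rpow_sub_one hy.ne' (a - 1)]
  simp only [Pi.neg_apply, Real.rpow_sub_one hy.ne' a]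
  field_simp
  ring

/-- if `v` solves `Δ_x v + (a/y) ∂_y v + ∂_y² v = 0` in the upper
half-space, then `w = -y^a ∂_y v` solves the conjugate equation
`Δ_x w - (a/y) ∂_y w + ∂_y² w = 0`. -/
theorem stmt_5 (n : ℕ) (hn : 1 ≤ n) (a : ℝ)
    (V : EuclideanSpace ℝ (Fin n) × ℝ → ℝ)
    (hV : ContDiffOn ℝ 3 V {p : EuclideanSpace ℝ (Fin n) × ℝ | 0 < p.2})
    (heq : ∀ p : EuclideanSpace ℝ (Fin n) × ℝ, 0 < p.2 →
      lapX n V p + (a / p.2) * partialY V p + partialYY V p = 0) :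
    ∀ p : EuclideanSpace ℝ (Fin n) × ℝ, 0 < p.2 →
      lapX n (fun q => -q.2 ^ a * partialY V q) p
        - (a / p.2) * partialY (fun q => -q.2 ^ a * partialY V q) p
        + partialYY (fun q => -q.2 ^ a * partialY V q) p = 0 := by
  intro p hp
  set U : Set (EuclideanSpace ℝ (Fin n) × ℝ) := {p | 0 < p.2}
  have hU : IsOpen U := isOpen_upperHalf
  set e : EuclideanSpace ℝ (Fin n) × ℝ := (0, 1)
  let d (i : Fin n) : EuclideanSpace ℝ (Fin n) × ℝ := (EuclideanSpace.single i 1, 0)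
  have hdiff {F : EuclideanSpace ℝ (Fin n) × ℝ → ℝ} {k : WithTop ℕ∞} (hF : ContDiffOn ℝ k F U)
      (hk : k ≠ 0) {q} (hq : q ∈ U) : DifferentiableAt ℝ F q :=
    (hF.contDiffAt (hU.mem_nhds hq)).differentiableAt hk
  have hV2 : ContDiffOn ℝ 2 V U := hV.of_le (by norm_num)
  have hD (u) : ContDiffOn ℝ 2 (dirDeriv u V) U := hV.dirDeriv hU (by norm_num) u
  have hDD (u v) : ContDiffOn ℝ 1 (dirDeriv u (dirDeriv v V)) U :=
    (hD v).dirDeriv hU (by norm_num) u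
  have hY : Set.EqOn (partialY V) (dirDeriv e V) U := fun q hq =>
    partialY_eq_dirDeriv (hdiff hV (by norm_num) hq)
  have hYY (q) (hq : q ∈ U) : partialYY V q = dirDeriv e (dirDeriv e V) q :=
    deriv_deriv_comp_line hU hV2 (hasDerivAt_vertical q.1) hq
  have hg (t : ℝ) (ht : 0 < t) : HasDerivAt (fun s => dirDeriv e V (p.1, s))
      (dirDeriv e (dirDeriv e V) (p.1, t)) t :=
    hasDerivAt_comp_line (γ := fun s => (p.1, s)) (hdiff (hD e) (by norm_num) ht)
      (hasDerivAt_vertical p.1 t)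
  have hg' : HasDerivAt (fun s => dirDeriv e (dirDeriv e V) (p.1, s))
      (dirDeriv e (dirDeriv e (dirDeriv e V)) p) p.2 :=
    hasDerivAt_comp_line (γ := fun s => (p.1, s)) (hdiff (hDD e e) (by norm_num) hp)
      (hasDerivAt_vertical p.1 p.2)
  have hlap : lapX n (partialY V) p
      = ∑ i, dirDeriv e (dirDeriv (d i) (dirDeriv (d i) V)) p := by
    rw [lapX_congr_upperHalf hY hp, lapX_eq_sum_dirDeriv hU (hD e) hp]
    refine Finset.sum_congr rfl fun i _ => ?_
    exact ((dirDeriv_comm hU hV2 (d i) e).dirDeriv hU (d i) hp).trans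
      (dirDeriv_comm hU (hD (d i)) (d i) e hp)
  have hsum : HasDerivAt (fun s => ∑ i, dirDeriv (d i) (dirDeriv (d i) V) (p.1, s))
      (∑ i, dirDeriv e (dirDeriv (d i) (dirDeriv (d i) V)) p) p.2 :=
    HasDerivAt.fun_sum fun i _ => hasDerivAt_comp_line (γ := fun s => (p.1, s))
      (hdiff (hDD (d i) (d i)) (by norm_num) hp) (hasDerivAt_vertical p.1 p.2)
  have hzero : (fun s => (∑ i, dirDeriv (d i) (dirDeriv (d i) V) (p.1, s))
      + a / s * dirDeriv e V (p.1, s) + dirDeriv e (dirDeriv e V) (p.1, s))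
      =ᶠ[𝓝 p.2] fun _ => (0 : ℝ) := by
    filter_upwards [lt_mem_nhds hp] with s hs
    have hmem : (p.1, s) ∈ U := hs
    rw [← heq (p.1, s) hs, lapX_eq_sum_dirDeriv hU hV2 hmem, hY hmem, hYY _ hmem]
  have hdiv : HasDerivAt (fun s : ℝ => a / s) (-a / p.2 ^ 2) p.2 := by
    simpa [div_eq_mul_inv] using (hasDerivAt_inv hp.ne').const_mul a
  have hODE := ((hsum.fun_add (hdiv.fun_mul (hg p.2 hp))).fun_add hg').unique
    (hzero.hasDerivAt_iff.2 (hasDerivAt_const p.2 0))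
  have hconj := conjugate_deriv_identity hp (a := a)
    (w := fun t => -t ^ a * partialY V (p.1, t)) (fun t ht => by rw [hY (x := (p.1, t)) ht]) hg hg'
  rw [lapX_mul_of_snd n (fun y => -y ^ a) (partialY V) p, hlap]
  simp only [partialYY]
  rw [partialY]
  linear_combination hconj - p.2 ^ a * hODE
end

section
/- Let n ≥ 1 be an integer, s ∈ (0,1), and β a real number with 0 < β < n + 2 − 2s. Let e ∈ ℝⁿ be a unit vector and a = 1 − 2s. Then the integral ∫_{ℝⁿ×(0,∞)} y^{a+2} (|x|² + y²)^{−(β+2)/2} (|x−e|² + y²)^{−(n+2−2s)/2} dx dy is finite. -/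
open MeasureTheory Real

section

variable {E : Type*} [NormedAddCommGroup E] [NormedSpace ℝ E] [FiniteDimensional ℝ E]
  [Nontrivial E] [MeasurableSpace E] [BorelSpace E] (μ : Measure E) [μ.IsAddHaarMeasure]

/-- A power of the norm is integrable on a ball as soon as its exponent exceeds minus the
dimension. -/
theorem integrableOn_norm_rpow_ball {r : ℝ} (hr : -(Module.finrank ℝ E : ℝ) < r) (R : ℝ) :
    IntegrableOn (fun x : E => ‖x‖ ^ r) (Metric.ball 0 R) μ := by
  refine integrableOn_ball_of_norm_le_rpow (C := 1) (α := -r) Module.finrank_pos (by linarith)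
    (.of_forall fun x => ?_) (Measurable.aestronglyMeasurable (by fun_prop))
  rw [one_mul, neg_neg, Real.norm_of_nonneg (by positivity)]

/-- A function dominated by `min ‖x‖ ‖x - q‖ ^ γ * ‖x‖ ^ (-b) * ‖x - q‖ ^ (-c)`, where `q` is a unit
vector, is integrable as soon as this bound is integrable near `0`, near `q` and at infinity. -/
theorem integrable_of_norm_le_two_poles {f : E → ℝ} (hf : AEStronglyMeasurable f μ)
    {q : E} (hq : ‖q‖ = 1) {γ b c : ℝ} (hγ : 0 ≤ γ)
    (hb : b < Module.finrank ℝ E + γ) (hc : c < Module.finrank ℝ E + γ)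
    (hbc : Module.finrank ℝ E + γ < b + c)
    (h : ∀ x, x ≠ 0 → x ≠ q →
      ‖f x‖ ≤ min ‖x‖ ‖x - q‖ ^ γ * ‖x‖ ^ (-b) * ‖x - q‖ ^ (-c)) :
    Integrable f μ := by
  have h0 : Integrable ((Metric.ball (0 : E) (1 / 2)).indicator fun x => ‖x‖ ^ (γ - b)) μ :=
    (integrable_indicator_iff Metric.isOpen_ball.measurableSet).mpr
      (integrableOn_norm_rpow_ball μ (by linarith) _)
  have h1 : Integrable ((Metric.ball (0 : E) (1 / 2)).indicator fun x => ‖x‖ ^ (γ - c)) μ :=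
    (integrable_indicator_iff Metric.isOpen_ball.measurableSet).mpr
      (integrableOn_norm_rpow_ball μ (by linarith) _)
  have h2 : Integrable (fun x : E => (1 + ‖x‖) ^ (-(b + c - γ))) μ :=
    integrable_one_add_norm (by linarith)
  refine (((h0.const_mul ((1 / 2 : ℝ) ^ (-c))).add
    ((h1.comp_sub_right q).const_mul ((1 / 2 : ℝ) ^ (-b)))).add
    (h2.const_mul ((1 / 3 : ℝ) ^ (-b) * (1 / 5 : ℝ) ^ (-c)))).mono' hf ?_
  have hne : ∀ᵐ x ∂μ, x ≠ 0 ∧ x ≠ q := by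
    filter_upwards [(Set.countable_singleton (0 : E)).ae_notMem μ,
      (Set.countable_singleton q).ae_notMem μ] with x hx hx'
    exact ⟨hx, hx'⟩
  filter_upwards [hne] with x hx
  have hN : 0 < ‖x‖ := norm_pos_iff.mpr hx.1
  have hM : 0 < ‖x - q‖ := norm_pos_iff.mpr (sub_ne_zero.mpr hx.2)
  have htri : 1 ≤ ‖x‖ + ‖x - q‖ := by
    have := norm_sub_le x (x - q)
    rwa [sub_sub_cancel, hq] at this
  have htri' : ‖x‖ ≤ ‖x - q‖ + 1 := by
    have := norm_add_le (x - q) q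
    rwa [sub_add_cancel, hq] at this
  have hmin : 0 < min ‖x‖ ‖x - q‖ := lt_min hN hM
  have hA : 0 ≤ (1 / 2 : ℝ) ^ (-c) *
      (Metric.ball (0 : E) (1 / 2)).indicator (fun x => ‖x‖ ^ (γ - b)) x :=
    mul_nonneg (by positivity) (Set.indicator_nonneg (fun _ _ => by positivity) _)
  have hB : 0 ≤ (1 / 2 : ℝ) ^ (-b) *
      (Metric.ball (0 : E) (1 / 2)).indicator (fun x => ‖x‖ ^ (γ - c)) (x - q) :=
    mul_nonneg (by positivity) (Set.indicator_nonneg (fun _ _ => by positivity) _)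
  have hC : 0 ≤ (1 / 3 : ℝ) ^ (-b) * (1 / 5 : ℝ) ^ (-c) * (1 + ‖x‖) ^ (-(b + c - γ)) := by
    positivity
  refine (h x hx.1 hx.2).trans ?_
  simp only [Pi.add_apply]
  by_cases hx0 : ‖x‖ < 1 / 2
  · have key : min ‖x‖ ‖x - q‖ ^ γ * ‖x‖ ^ (-b) * ‖x - q‖ ^ (-c) ≤ (1 / 2 : ℝ) ^ (-c) *
        (Metric.ball (0 : E) (1 / 2)).indicator (fun x => ‖x‖ ^ (γ - b)) x := by
      rw [Set.indicator_of_mem (by simpa using hx0), sub_eq_add_neg γ b, rpow_add hN,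
        mul_comm ((1 / 2 : ℝ) ^ (-c))]
      gcongr ?_ ^ γ * _ * ?_
      · exact min_le_left _ _
      · exact rpow_le_rpow_of_nonpos (by norm_num) (by linarith) (by linarith)
    linarith
  by_cases hx1 : ‖x - q‖ < 1 / 2
  · have key : min ‖x‖ ‖x - q‖ ^ γ * ‖x‖ ^ (-b) * ‖x - q‖ ^ (-c) ≤ (1 / 2 : ℝ) ^ (-b) *
        (Metric.ball (0 : E) (1 / 2)).indicator (fun x => ‖x‖ ^ (γ - c)) (x - q) := by
      rw [Set.indicator_of_mem (by simpa using hx1), sub_eq_add_neg γ c, rpow_add hM,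
        mul_comm ((1 / 2 : ℝ) ^ (-b)), mul_right_comm]
      gcongr ?_ ^ γ * _ * ?_
      · exact min_le_right _ _
      · exact rpow_le_rpow_of_nonpos (by norm_num) (by linarith) (by linarith)
    linarith
  push Not at hx0 hx1
  have key : min ‖x‖ ‖x - q‖ ^ γ * ‖x‖ ^ (-b) * ‖x - q‖ ^ (-c) ≤
      (1 + ‖x‖) ^ γ * (1 / 3 * (1 + ‖x‖)) ^ (-b) * (1 / 5 * (1 + ‖x‖)) ^ (-c) := by
    gcongr ?_ * ?_ * ?_
    · exact rpow_le_rpow hmin.le ((min_le_left _ _).trans (by linarith)) hγ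
    · exact rpow_le_rpow_of_nonpos (by positivity) (by linarith) (by linarith)
    · exact rpow_le_rpow_of_nonpos (by positivity) (by linarith) (by linarith)
  have hpow : (1 + ‖x‖) ^ γ * (1 / 3 * (1 + ‖x‖)) ^ (-b) * (1 / 5 * (1 + ‖x‖)) ^ (-c) =
      (1 / 3 : ℝ) ^ (-b) * (1 / 5 : ℝ) ^ (-c) * (1 + ‖x‖) ^ (-(b + c - γ)) := by
    have h1x : 0 < 1 + ‖x‖ := by positivity
    rw [mul_rpow (by norm_num) h1x.le, mul_rpow (by norm_num) h1x.le,
      show -(b + c - γ) = γ + -b + -c by ring, rpow_add h1x, rpow_add h1x]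
    ring
  linarith

end

/-- The Euclidean norm on a product dominates the supremum norm, for negative powers. -/
theorem sq_add_sq_rpow_neg_le {E : Type*} [NormedAddCommGroup E] {p : E × ℝ} (hp : p ≠ 0)
    {c : ℝ} (hc : 0 ≤ c) : (‖p.1‖ ^ 2 + p.2 ^ 2) ^ (-(c / 2)) ≤ ‖p‖ ^ (-c) := by
  have hp' : 0 < ‖p‖ := norm_pos_iff.mpr hp
  have hle : ‖p‖ ^ 2 ≤ ‖p.1‖ ^ 2 + p.2 ^ 2 := by
    rw [Prod.norm_def]
    rcases max_cases ‖p.1‖ ‖p.2‖ with h | h <;> rw [h.1]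
    · nlinarith [sq_nonneg p.2]
    · rw [Real.norm_eq_abs, sq_abs]
      nlinarith [sq_nonneg ‖p.1‖]
  calc (‖p.1‖ ^ 2 + p.2 ^ 2) ^ (-(c / 2)) ≤ (‖p‖ ^ 2) ^ (-(c / 2)) :=
        rpow_le_rpow_of_nonpos (by positivity) hle (by linarith)
    _ = ‖p‖ ^ (-c) := by
        rw [← rpow_natCast ‖p‖ 2, ← rpow_mul hp'.le]
        congr 1
        push_cast
        ring

/-- finiteness of the kernel integral defining the constant
`A_{n,s,β}`, for `0 < β < n + 2 - 2s`. -/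
theorem stmt_8 (n : ℕ) (hn : 1 ≤ n) (s : ℝ) (hs0 : 0 < s) (hs1 : s < 1)
    (a : ℝ) (ha : a = 1 - 2 * s)
    (β : ℝ) (hβ0 : 0 < β) (hβ : β < (n : ℝ) + 2 - 2 * s)
    (e : EuclideanSpace ℝ (Fin n)) (he : ‖e‖ = 1) :
    IntegrableOn
      (fun p : EuclideanSpace ℝ (Fin n) × ℝ =>
        p.2 ^ (a + 2) * (‖p.1‖ ^ 2 + p.2 ^ 2) ^ (-((β + 2) / 2))
          * (‖p.1 - e‖ ^ 2 + p.2 ^ 2) ^ (-(((n : ℝ) + 2 - 2 * s) / 2)))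
      {p : EuclideanSpace ℝ (Fin n) × ℝ | 0 < p.2} := by
  have hn' : (1 : ℝ) ≤ n := by exact_mod_cast hn
  have hS : MeasurableSet {p : EuclideanSpace ℝ (Fin n) × ℝ | 0 < p.2} :=
    measurableSet_lt measurable_const measurable_snd
  have hdim : (Module.finrank ℝ (EuclideanSpace ℝ (Fin n) × ℝ) : ℝ) = n + 1 := by simp
  have : (volume : Measure (EuclideanSpace ℝ (Fin n) × ℝ)).IsAddHaarMeasure := by
    rw [Measure.volume_eq_prod]
    infer_instance
  rw [← integrable_indicator_iff hS]
  refine integrable_of_norm_le_two_poles volume (q := (e, 0)) (γ := a + 2) (b := β + 2)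
    (c := n + 2 - 2 * s) ?_ (by simp [Prod.norm_def, he]) (by linarith)
    (by linarith) (by linarith) (by linarith) fun p hp hpe => ?_
  · exact (Measurable.indicator (by fun_prop) hS).aestronglyMeasurable
  have hpe' : p - (e, 0) ≠ 0 := sub_ne_zero.mpr hpe
  by_cases hy : 0 < p.2
  · have hmin : p.2 ≤ min ‖p‖ ‖p - (e, 0)‖ := by
      refine le_min ((le_abs_self _).trans (norm_snd_le p)) ?_
      have := norm_snd_le (p - (e, 0))
      rw [Prod.snd_sub, sub_zero] at this
      exact (le_abs_self _).trans this
    have h1 := sq_add_sq_rpow_neg_le hp (c := β + 2) (by linarith)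
    have h2 := sq_add_sq_rpow_neg_le hpe' (c := n + 2 - 2 * s) (by linarith)
    simp only [Prod.fst_sub, Prod.snd_sub, sub_zero] at h2
    rw [Set.indicator_of_mem (show p ∈ {p : EuclideanSpace ℝ (Fin n) × ℝ | 0 < p.2} from hy),
      Real.norm_of_nonneg (by positivity)]
    gcongr
    linarith
  · rw [Set.indicator_of_notMem (by exact hy), norm_zero]
    positivity
end

section
/- Let n ≥ 1 be an integer, s ∈ (0,1) with n > 2s, and β a real number with 0 < β < n − 2s. Then there exists a constant C, depending only on n, s and β, such that for every x ∈ ℝⁿ with 0 < |x| ≤ 1 one has ∫_{B₁} |z|^{β−n} |x−z|^{2s−n} dz ≤ C |x|^{β+2s−n}, where B₁ ⊂ ℝⁿ is the open unit ball centered at the origin. -/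
open MeasureTheory Real

section RadialPowers

open Set Module

variable {E : Type*} [NormedAddCommGroup E] [NormedSpace ℝ E] [FiniteDimensional ℝ E]
  [Nontrivial E]

lemma pow_finrank_sub_one_mul_rpow {a y : ℝ} (hy : 0 < y) :
    y ^ (finrank ℝ E - 1) * y ^ a = y ^ ((finrank ℝ E : ℝ) - 1 + a) := by
  have hd : 1 ≤ finrank ℝ E := finrank_pos
  rw [← rpow_natCast, ← rpow_add hy, Nat.cast_sub hd, Nat.cast_one]

lemma radial_indicator_Iic_eqOn (a ρ : ℝ) :
    EqOn (fun y : ℝ ↦ y ^ (finrank ℝ E - 1) • (Iic ρ).indicator (fun t : ℝ ↦ t ^ a) y)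
      ((Iic ρ).indicator fun y ↦ y ^ ((finrank ℝ E : ℝ) - 1 + a)) (Ioi 0) := by
  intro y hy
  by_cases h : y ∈ Iic ρ
  · simp only [indicator_of_mem h, smul_eq_mul, pow_finrank_sub_one_mul_rpow hy]
  · simp only [indicator_of_notMem h, smul_zero]

lemma radial_indicator_Ioi_eqOn (a ρ : ℝ) :
    EqOn (fun y : ℝ ↦ y ^ (finrank ℝ E - 1) • (Ioi ρ).indicator (fun t : ℝ ↦ t ^ a) y)
      ((Ioi ρ).indicator fun y ↦ y ^ ((finrank ℝ E : ℝ) - 1 + a)) (Ioi 0) := by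
  intro y hy
  by_cases h : y ∈ Ioi ρ
  · simp only [indicator_of_mem h, smul_eq_mul, pow_finrank_sub_one_mul_rpow hy]
  · simp only [indicator_of_notMem h, smul_zero]

variable [MeasurableSpace E] [BorelSpace E] (μ : Measure E) [μ.IsAddHaarMeasure]

lemma integrable_indicator_Iic_norm_rpow {a ρ : ℝ} (ha : 0 < finrank ℝ E + a) (hρ : 0 < ρ) :
    Integrable (fun z : E ↦ (Iic ρ).indicator (fun t : ℝ ↦ t ^ a) ‖z‖) μ := by
  rw [integrable_fun_norm_addHaar μ,
    integrableOn_congr_fun (radial_indicator_Iic_eqOn (E := E) a ρ) measurableSet_Ioi,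
    IntegrableOn, integrable_indicator_iff measurableSet_Iic, IntegrableOn,
    Measure.restrict_restrict measurableSet_Iic, inter_comm, Ioi_inter_Iic]
  exact (intervalIntegrable_iff_integrableOn_Ioc_of_le hρ.le).1
    (intervalIntegral.intervalIntegrable_rpow' (by linarith))

lemma integral_indicator_Iic_norm_rpow {a ρ : ℝ} (ha : 0 < finrank ℝ E + a) (hρ : 0 < ρ) :
    ∫ z : E, (Iic ρ).indicator (fun t : ℝ ↦ t ^ a) ‖z‖ ∂μ =
      finrank ℝ E * μ.real (Metric.ball 0 1) * (ρ ^ (finrank ℝ E + a) / (finrank ℝ E + a)) := by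
  rw [integral_fun_norm_addHaar μ,
    setIntegral_congr_fun measurableSet_Ioi (radial_indicator_Iic_eqOn (E := E) a ρ),
    setIntegral_indicator measurableSet_Iic, Ioi_inter_Iic,
    ← intervalIntegral.integral_of_le hρ.le, integral_rpow (Or.inl (by linarith)),
    show (finrank ℝ E : ℝ) - 1 + a + 1 = finrank ℝ E + a by ring, zero_rpow ha.ne', sub_zero,
    nsmul_eq_mul, smul_eq_mul, mul_assoc]

lemma integrable_indicator_Ioi_norm_rpow {a ρ : ℝ} (ha : finrank ℝ E + a < 0) (hρ : 0 < ρ) :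
    Integrable (fun z : E ↦ (Ioi ρ).indicator (fun t : ℝ ↦ t ^ a) ‖z‖) μ := by
  rw [integrable_fun_norm_addHaar μ,
    integrableOn_congr_fun (radial_indicator_Ioi_eqOn (E := E) a ρ) measurableSet_Ioi,
    IntegrableOn, integrable_indicator_iff measurableSet_Ioi, IntegrableOn,
    Measure.restrict_restrict measurableSet_Ioi, Ioi_inter_Ioi, sup_of_le_left hρ.le]
  exact integrableOn_Ioi_rpow_of_lt (by linarith) hρ

lemma integral_indicator_Ioi_norm_rpow {a ρ : ℝ} (ha : finrank ℝ E + a < 0) (hρ : 0 < ρ) :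
    ∫ z : E, (Ioi ρ).indicator (fun t : ℝ ↦ t ^ a) ‖z‖ ∂μ =
      finrank ℝ E * μ.real (Metric.ball 0 1) * (ρ ^ (finrank ℝ E + a) / -(finrank ℝ E + a)) := by
  rw [integral_fun_norm_addHaar μ,
    setIntegral_congr_fun measurableSet_Ioi (radial_indicator_Ioi_eqOn (E := E) a ρ),
    setIntegral_indicator measurableSet_Ioi, Ioi_inter_Ioi, sup_of_le_right hρ.le,
    integral_Ioi_rpow_of_lt (by linarith) hρ,
    show (finrank ℝ E : ℝ) - 1 + a + 1 = finrank ℝ E + a by ring,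
    nsmul_eq_mul, smul_eq_mul, mul_assoc, div_neg, neg_div]

end RadialPowers

section RieszComposition

open Set Module

lemma norm_rpow_mul_norm_sub_rpow_le {E : Type*} [NormedAddCommGroup E] {a b : ℝ} (ha : a ≤ 0)
    (hb : b ≤ 0) {x : E} (hx : 0 < ‖x‖) (z : E) :
    ‖z‖ ^ a * ‖x - z‖ ^ b ≤
      (‖x‖ / 2) ^ b * (Iic (‖x‖ / 2)).indicator (fun t : ℝ ↦ t ^ a) ‖z‖ +
      (‖x‖ / 2) ^ a * (Iic (‖x‖ / 2)).indicator (fun t : ℝ ↦ t ^ b) ‖x - z‖ +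
      3 ^ (-b) * (Ioi (‖x‖ / 2)).indicator (fun t : ℝ ↦ t ^ (a + b)) ‖z‖ := by
  have hρ : 0 < ‖x‖ / 2 := by positivity
  have tri : ‖x‖ ≤ ‖x - z‖ + ‖z‖ := by simpa using norm_add_le (x - z) z
  have tri' : ‖z‖ ≤ ‖x‖ + ‖x - z‖ := by simpa using norm_sub_le x (x - z)
  have nonneg_ind : ∀ (S : Set ℝ) (c : ℝ) (w : E),
      0 ≤ S.indicator (fun t : ℝ ↦ t ^ c) ‖w‖ := fun S c w ↦
    indicator_apply_nonneg fun _ ↦ rpow_nonneg (norm_nonneg _) _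
  have h₁ : 0 ≤ (‖x‖ / 2) ^ b * (Iic (‖x‖ / 2)).indicator (fun t : ℝ ↦ t ^ a) ‖z‖ :=
    mul_nonneg (rpow_nonneg hρ.le _) (nonneg_ind _ _ _)
  have h₂ : 0 ≤ (‖x‖ / 2) ^ a * (Iic (‖x‖ / 2)).indicator (fun t : ℝ ↦ t ^ b) ‖x - z‖ :=
    mul_nonneg (rpow_nonneg hρ.le _) (nonneg_ind _ _ _)
  have h₃ : 0 ≤ (3 : ℝ) ^ (-b) * (Ioi (‖x‖ / 2)).indicator (fun t : ℝ ↦ t ^ (a + b)) ‖z‖ :=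
    mul_nonneg (by positivity) (nonneg_ind _ _ _)
  rcases le_or_gt ‖z‖ (‖x‖ / 2) with hz | hz
  · have : ‖z‖ ^ a * ‖x - z‖ ^ b ≤
        (‖x‖ / 2) ^ b * (Iic (‖x‖ / 2)).indicator (fun t : ℝ ↦ t ^ a) ‖z‖ := by
      rw [indicator_of_mem (mem_Iic.2 hz), mul_comm]
      exact mul_le_mul_of_nonneg_right (rpow_le_rpow_of_nonpos hρ (by linarith) hb)
        (rpow_nonneg (norm_nonneg _) _)
    linarith
  rcases le_or_gt ‖x - z‖ (‖x‖ / 2) with hxz | hxz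
  · have : ‖z‖ ^ a * ‖x - z‖ ^ b ≤
        (‖x‖ / 2) ^ a * (Iic (‖x‖ / 2)).indicator (fun t : ℝ ↦ t ^ b) ‖x - z‖ := by
      rw [indicator_of_mem (mem_Iic.2 hxz)]
      exact mul_le_mul_of_nonneg_right (rpow_le_rpow_of_nonpos hρ hz.le ha)
        (rpow_nonneg (norm_nonneg _) _)
    linarith
  · have : ‖z‖ ^ a * ‖x - z‖ ^ b ≤
        3 ^ (-b) * (Ioi (‖x‖ / 2)).indicator (fun t : ℝ ↦ t ^ (a + b)) ‖z‖ := by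
      have hz0 : 0 < ‖z‖ := hρ.trans hz
      rw [indicator_of_mem (mem_Ioi.2 hz)]
      calc ‖z‖ ^ a * ‖x - z‖ ^ b ≤ ‖z‖ ^ a * (‖z‖ / 3) ^ b :=
            mul_le_mul_of_nonneg_left
              (rpow_le_rpow_of_nonpos (by positivity) (by linarith) hb)
              (rpow_nonneg (norm_nonneg _) _)
        _ = 3 ^ (-b) * ‖z‖ ^ (a + b) := by
            rw [div_rpow hz0.le (by norm_num), rpow_add hz0, rpow_neg (by norm_num)]
            ring
    linarith

/-- The composition of two Riesz-type kernels over any set is bounded by a single kernel. -/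
theorem exists_setIntegral_norm_rpow_mul_norm_sub_rpow_le {E : Type*} [NormedAddCommGroup E]
    [NormedSpace ℝ E] [FiniteDimensional ℝ E] [Nontrivial E] [MeasurableSpace E] [BorelSpace E]
    (μ : Measure E) [μ.IsAddHaarMeasure] {a b : ℝ} (ha : 0 < finrank ℝ E + a)
    (hb : 0 < finrank ℝ E + b) (hab : finrank ℝ E + (a + b) < 0) :
    ∃ C > 0, ∀ x : E, 0 < ‖x‖ → ∀ S : Set E,
      ∫ z in S, ‖z‖ ^ a * ‖x - z‖ ^ b ∂μ ≤ C * ‖x‖ ^ (finrank ℝ E + (a + b)) := by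
  set d : ℝ := (finrank ℝ E : ℝ) with hd
  have hd0 : 0 < d := by rw [hd]; exact_mod_cast finrank_pos (R := ℝ) (M := E)
  set V : ℝ := μ.real (Metric.ball 0 1) with hV
  have hV0 : 0 < V :=
    ENNReal.toReal_pos (Metric.measure_ball_pos μ _ one_pos).ne' measure_ball_lt_top.ne
  have hab' : 0 < -(d + (a + b)) := by linarith
  refine ⟨d * V * (1 / (d + a) + 1 / (d + b) + 3 ^ (-b) / -(d + (a + b))) *
    (1 / 2) ^ (d + (a + b)), by positivity, fun x hx S ↦ ?_⟩
  have hρ : 0 < ‖x‖ / 2 := by positivity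
  set G : E → ℝ := fun z ↦
    (‖x‖ / 2) ^ b * (Iic (‖x‖ / 2)).indicator (fun t : ℝ ↦ t ^ a) ‖z‖ +
    (‖x‖ / 2) ^ a * (Iic (‖x‖ / 2)).indicator (fun t : ℝ ↦ t ^ b) ‖x - z‖ +
    3 ^ (-b) * (Ioi (‖x‖ / 2)).indicator (fun t : ℝ ↦ t ^ (a + b)) ‖z‖ with hG
  have hle : ∀ z, ‖z‖ ^ a * ‖x - z‖ ^ b ≤ G z :=
    norm_rpow_mul_norm_sub_rpow_le (by linarith) (by linarith) hx
  have hnonneg : ∀ z, 0 ≤ ‖z‖ ^ a * ‖x - z‖ ^ b := fun z ↦ by positivity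
  have i₁ := (integrable_indicator_Iic_norm_rpow μ ha hρ).const_mul ((‖x‖ / 2) ^ b)
  have i₂ := ((integrable_indicator_Iic_norm_rpow μ hb hρ).comp_sub_left x).const_mul
    ((‖x‖ / 2) ^ a)
  have i₃ := (integrable_indicator_Ioi_norm_rpow μ hab hρ).const_mul (3 ^ (-b))
  have hGi : Integrable G μ := (i₁.add i₂).add i₃
  calc ∫ z in S, ‖z‖ ^ a * ‖x - z‖ ^ b ∂μ ≤ ∫ z in S, G z ∂μ :=
        integral_mono_of_nonneg (.of_forall hnonneg) hGi.integrableOn (.of_forall hle)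
    _ ≤ ∫ z, G z ∂μ :=
        setIntegral_le_integral hGi (.of_forall fun z ↦ (hnonneg z).trans (hle z))
    _ = _ := by
      have h₁ : (‖x‖ / 2) ^ b * (‖x‖ / 2) ^ (d + a) = (‖x‖ / 2) ^ (d + (a + b)) := by
        rw [← rpow_add hρ]; ring_nf
      have h₂ : (‖x‖ / 2) ^ a * (‖x‖ / 2) ^ (d + b) = (‖x‖ / 2) ^ (d + (a + b)) := by
        rw [← rpow_add hρ]; ring_nf
      have h₃ : (‖x‖ / 2) ^ (d + (a + b)) =
          (1 / 2) ^ (d + (a + b)) * ‖x‖ ^ (d + (a + b)) := by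
        rw [← mul_rpow (by norm_num) hx.le]; ring_nf
      simp only [hG]
      rw [integral_add (by exact i₁.add i₂) i₃, integral_add i₁ i₂, integral_const_mul,
        integral_const_mul, integral_const_mul,
        integral_sub_left_eq_self
          (fun w : E ↦ (Iic (‖x‖ / 2)).indicator (fun t : ℝ ↦ t ^ b) ‖w‖) μ x,
        integral_indicator_Iic_norm_rpow μ ha hρ, integral_indicator_Iic_norm_rpow μ hb hρ,
        integral_indicator_Ioi_norm_rpow μ hab hρ]
      simp only [← hd, ← hV]
      linear_combination (d * V / (d + a)) * h₁ + (d * V / (d + b)) * h₂ +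
        (d * V * (1 / (d + a) + 1 / (d + b) + 3 ^ (-b) / -(d + (a + b)))) * h₃

end RieszComposition

/-- Riesz-composition kernel estimate: for `0 < β < n - 2s`,
`∫_{B₁} |z|^{β-n} |x-z|^{2s-n} dz ≤ C |x|^{β+2s-n}` for `0 < |x| ≤ 1`. -/
theorem stmt_14 (n : ℕ) (hn : 1 ≤ n) (s : ℝ) (hs0 : 0 < s) (hs1 : s < 1)
    (hns : 2 * s < (n : ℝ)) (β : ℝ) (hβ0 : 0 < β) (hβ : β < (n : ℝ) - 2 * s) :
    ∃ C > 0, ∀ x : EuclideanSpace ℝ (Fin n), 0 < ‖x‖ → ‖x‖ ≤ 1 →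
      (∫ z in Metric.ball (0 : EuclideanSpace ℝ (Fin n)) 1,
          ‖z‖ ^ (β - (n : ℝ)) * ‖x - z‖ ^ (2 * s - (n : ℝ)))
        ≤ C * ‖x‖ ^ (β + 2 * s - (n : ℝ)) := by
  have hdim : Module.finrank ℝ (EuclideanSpace ℝ (Fin n)) = n := finrank_euclideanSpace_fin
  have : Nontrivial (EuclideanSpace ℝ (Fin n)) :=
    Module.nontrivial_of_finrank_pos (R := ℝ) (by omega)
  obtain ⟨C, hC, h⟩ := exists_setIntegral_norm_rpow_mul_norm_sub_rpow_le
    (volume : Measure (EuclideanSpace ℝ (Fin n))) (a := β - n) (b := 2 * s - n)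
    (by rw [hdim]; linarith) (by rw [hdim]; linarith) (by rw [hdim]; linarith)
  refine ⟨C, hC, fun x hx _ ↦ (h x hx _).trans_eq ?_⟩
  rw [hdim]
  ring_nf
end
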